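/- Let k be a field of characteristic not 2 containing an element i with i² = -1, and let n ≥ 1. If A, B ∈ Sp(2n,k) both satisfy A² = -I and B² = -I, then there exists Q ∈ Sp(2n,k) such that Q⁻¹AQ = B. -/

import Mathlib

open Matrix

/-- The standard symplectic form matrix `J = [[0, Iₙ], [-Iₙ, 0]]`. -/
def SpJ (n : ℕ) (R : Type*) [CommRing R] : Matrix (Fin n ⊕ Fin n) (Fin n ⊕ Fin n) R :=
  Matrix.fromBlocks 0 1 (-1) 0

/-- `M` belongs to the symplectic group `Sp(2n,R)`, i.e. `Mᵀ J M = J`. -/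
def IsSymp {n : ℕ} {R : Type*} [CommRing R]
    (M : Matrix (Fin n ⊕ Fin n) (Fin n ⊕ Fin n) R) : Prop :=
  Mᵀ * SpJ n R * M = SpJ n R

namespace Matrix

/-- Rank factorization of a square matrix. -/
theorem exists_mul_eq_of_rank_eq {k m : Type*} [Field k] [Fintype m] [DecidableEq m]
    (M : Matrix m m k) {r : ℕ} (hr : M.rank = r) :
    ∃ (X : Matrix m (Fin r) k) (Y : Matrix (Fin r) m k), X * Y = M := by
  subst hr
  obtain ⟨V, U, e, hV, hU, h⟩ := exists_rank_normal_form M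
  have hV' := (isUnit_iff_isUnit_det V).1 hV
  have hU' := (isUnit_iff_isUnit_det U).1 hU
  refine ⟨V⁻¹ * (fromRows 1 0 : Matrix _ (Fin M.rank) k).submatrix e id,
    (fromCols 1 0 : Matrix (Fin M.rank) _ k).submatrix id e * U⁻¹, ?_⟩
  have key : (fromRows 1 0 : Matrix _ (Fin M.rank) k).submatrix e id *
      (fromCols 1 0 : Matrix (Fin M.rank) _ k).submatrix id e = V * M * U := by
    rw [h, ← submatrix_mul _ _ _ _ _ Function.bijective_id, fromRows_mul_fromCols]
    simp
  calc _ = V⁻¹ * ((fromRows 1 0 : Matrix _ (Fin M.rank) k).submatrix e id *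
        (fromCols 1 0 : Matrix (Fin M.rank) _ k).submatrix id e) * U⁻¹ := by
        simp only [Matrix.mul_assoc]
    _ = M := by
        rw [key, Matrix.mul_assoc V, nonsing_inv_mul_cancel_left _ _ hV',
          mul_nonsing_inv_cancel_right _ _ hU']

/-- A matrix and its complement to the identity have ranks summing to at least the size. -/
theorem card_le_rank_add_rank_one_sub {k m : Type*} [Field k] [Fintype m] [DecidableEq m]
    (P : Matrix m m k) : Fintype.card m ≤ P.rank + (1 - P).rank := by
  obtain ⟨X, X', hX⟩ := exists_mul_eq_of_rank_eq P rfl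
  obtain ⟨Y, Y', hY⟩ := exists_mul_eq_of_rank_eq (1 - P) rfl
  have h : fromCols X Y * fromRows X' Y' = 1 := by
    rw [fromCols_mul_fromRows, hX, hY, add_sub_cancel]
  have h1 : (fromCols X Y * fromRows X' Y').rank = Fintype.card m := by rw [h, rank_one]
  rw [← h1]
  refine (rank_mul_le_left _ _).trans ((rank_le_card_width _).trans ?_)
  simp

/-- An idempotent matrix of half rank is similar to `fromBlocks 1 0 0 0`. -/
theorem exists_isUnit_mul_eq_mul_fromBlocks {k : Type*} [Field k] {n : ℕ}
    {P : Matrix (Fin n ⊕ Fin n) (Fin n ⊕ Fin n) k}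
    (h1 : P.rank = n) (h2 : (1 - P).rank = n) :
    ∃ S : Matrix (Fin n ⊕ Fin n) (Fin n ⊕ Fin n) k,
      IsUnit S ∧ P * S = S * fromBlocks 1 0 0 0 := by
  obtain ⟨X, X', hX⟩ := exists_mul_eq_of_rank_eq P h1
  obtain ⟨Y, Y', hY⟩ := exists_mul_eq_of_rank_eq (1 - P) h2
  have h : fromCols X Y * fromRows X' Y' = 1 := by
    rw [fromCols_mul_fromRows, hX, hY, add_sub_cancel]
  have h' := mul_eq_one_comm.1 h
  refine ⟨fromCols X Y, IsUnit.of_mul_eq_one _ h, ?_⟩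
  rw [fromRows_mul_fromCols, ← fromBlocks_one, fromBlocks_inj] at h'
  obtain ⟨a, b, -, -⟩ := h'
  rw [mul_fromCols, fromCols_mul_fromBlocks, ← hX, Matrix.mul_assoc, Matrix.mul_assoc, a, b]
  simp

end Matrix

section Symplectic

variable {n : ℕ}

theorem SpJ_eq_neg_J (R : Type*) [CommRing R] : SpJ n R = -J (Fin n) R := by
  simp [SpJ, J, fromBlocks_neg]

theorem isUnit_SpJ (R : Type*) [CommRing R] : IsUnit (SpJ n R) := by
  rw [SpJ_eq_neg_J, IsUnit.neg_iff, isUnit_iff_isUnit_det]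
  exact isUnit_det_J _ _

theorem SpJ_transpose (R : Type*) [CommRing R] : (SpJ n R)ᵀ = -SpJ n R := by
  simp [SpJ_eq_neg_J]

theorem IsSymp.isUnit_det {R : Type*} [CommRing R]
    {M : Matrix (Fin n ⊕ Fin n) (Fin n ⊕ Fin n) R} (h : IsSymp M) : IsUnit M.det := by
  refine SymplecticGroup.symplectic_det (SymplecticGroup.mem_iff'.2 ?_)
  simpa [IsSymp, SpJ_eq_neg_J] using h

theorem IsSymp.mul {R : Type*} [CommRing R]
    {M N : Matrix (Fin n ⊕ Fin n) (Fin n ⊕ Fin n) R} (hM : IsSymp M) (hN : IsSymp N) :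
    IsSymp (M * N) := by
  unfold IsSymp at *
  calc _ = Nᵀ * (Mᵀ * SpJ n R * M) * N := by simp only [transpose_mul, Matrix.mul_assoc]
    _ = _ := by rw [hM, hN]

theorem IsSymp.inv {R : Type*} [CommRing R]
    {M : Matrix (Fin n ⊕ Fin n) (Fin n ⊕ Fin n) R} (hM : IsSymp M) : IsSymp M⁻¹ := by
  have hu := hM.isUnit_det
  unfold IsSymp at *
  calc _ = (M * M⁻¹)ᵀ * SpJ n R * (M * M⁻¹) := by
        nth_rw 1 [← hM]
        simp only [transpose_mul, Matrix.mul_assoc]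
    _ = _ := by simp [mul_nonsing_inv _ hu]

/-- A skew-symmetric invertible matrix `G` satisfying `D * G * D = G` with `D = diag(i, -i)` is
congruent to the standard symplectic form by a matrix commuting with `D`. -/
theorem exists_congr_SpJ {k : Type*} [Field k] (hchar : (2 : k) ≠ 0) {i : k} (hi : i ^ 2 = -1)
    {G : Matrix (Fin n ⊕ Fin n) (Fin n ⊕ Fin n) k} (hG : IsUnit G) (hskew : Gᵀ = -G)
    (hD : fromBlocks (i • 1) 0 0 (-i • 1) * G * fromBlocks (i • 1) 0 0 (-i • 1) = G) :
    ∃ T : Matrix (Fin n ⊕ Fin n) (Fin n ⊕ Fin n) k,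
      Tᵀ * G * T = SpJ n k ∧
      fromBlocks (i • 1) 0 0 (-i • 1) * T = T * fromBlocks (i • 1) 0 0 (-i • 1) := by
  obtain ⟨H, hGH⟩ := hG.exists_right_inv
  have eq_zero_of_smul {M : Matrix (Fin n) (Fin n) k} (h : (i * i) • M = M) : M = 0 := by
    rw [← pow_two, hi, neg_smul, one_smul, eq_comm, ← add_eq_zero_iff_eq_neg, ← two_smul k] at h
    exact (smul_eq_zero.1 h).resolve_left hchar
  obtain ⟨a, b, c, d, rfl⟩ : ∃ a b c d, G = fromBlocks a b c d :=
    ⟨_, _, _, _, (fromBlocks_toBlocks G).symm⟩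
  obtain ⟨e, f, g, h, rfl⟩ : ∃ a b c d, H = fromBlocks a b c d :=
    ⟨_, _, _, _, (fromBlocks_toBlocks H).symm⟩
  simp only [fromBlocks_multiply, fromBlocks_transpose, fromBlocks_neg, fromBlocks_inj,
    ← fromBlocks_one] at hGH hskew hD
  obtain rfl : a = 0 := eq_zero_of_smul (by simpa [smul_smul] using hD.1)
  obtain rfl : d = 0 := eq_zero_of_smul (by simpa [smul_smul] using hD.2.2.2)
  have hbg : b * g = 1 := by simpa using hGH.1
  have hcb : c = -bᵀ := by rw [hskew.2.2.1, neg_neg]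
  have hgb : gᵀ * bᵀ = 1 := by rw [← transpose_mul, hbg, transpose_one]
  refine ⟨fromBlocks 1 0 0 g, ?_, ?_⟩
  · simp [fromBlocks_transpose, fromBlocks_multiply, SpJ, hbg, hcb, hgb]
  · simp [fromBlocks_multiply]

/-- A symplectic matrix of square `-1` is symplectically conjugate to `diag(i, -i)`. -/
theorem IsSymp.exists_mul_eq_mul_fromBlocks {k : Type*} [Field k] (hchar : (2 : k) ≠ 0)
    {i : k} (hi : i ^ 2 = -1) {A : Matrix (Fin n ⊕ Fin n) (Fin n ⊕ Fin n) k}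
    (hA : IsSymp A) (hA2 : A * A = -1) :
    ∃ Q : Matrix (Fin n ⊕ Fin n) (Fin n ⊕ Fin n) k,
      IsSymp Q ∧ A * Q = Q * fromBlocks (i • 1) 0 0 (-i • 1) := by
  have hii : i * i = -1 := by rw [← pow_two, hi]
  have hJA : Aᵀ * SpJ n k = -(SpJ n k * A) := by
    calc Aᵀ * SpJ n k = -(Aᵀ * SpJ n k * (A * A)) := by simp [hA2]
      _ = -(Aᵀ * SpJ n k * A * A) := by simp only [Matrix.mul_assoc]
      _ = _ := by rw [hA]
  obtain ⟨P, hP⟩ : ∃ P, P = (2⁻¹ : k) • (1 - i • A) := ⟨_, rfl⟩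
  have hP' : 1 - P = (2⁻¹ : k) • (1 + i • A) := by
    have : (1 : Matrix (Fin n ⊕ Fin n) (Fin n ⊕ Fin n) k) = (2⁻¹ : k) • (2 : k) • 1 := by
      rw [smul_smul, inv_mul_cancel₀ hchar, one_smul]
    rw [hP]
    nth_rw 1 [this]
    rw [← smul_sub, two_smul]
    congr 1
    abel
  have hAP : A = i • ((2 : k) • P - 1) := by
    rw [hP, smul_smul, mul_inv_cancel₀ hchar, one_smul, sub_sub_cancel_left, smul_neg, smul_smul,
      hii, neg_smul, one_smul, neg_neg]
  have hPP : P * (1 - P) = 0 := by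
    have h : (1 - i • A) * (1 + i • A) = 0 := by
      rw [sub_mul, mul_add, mul_add, smul_mul_smul_comm, hii, hA2]
      simp [add_comm]
    rw [hP', hP, smul_mul_smul_comm, h, smul_zero]
  have hrank : P.rank = (1 - P).rank := by
    have hJ := (isUnit_iff_isUnit_det _).1 (isUnit_SpJ (n := n) k)
    have h : (1 - P)ᵀ * SpJ n k = SpJ n k * P := by
      rw [hP', hP]
      simp [add_mul, mul_add, hJA, sub_eq_add_neg]
    rw [← rank_transpose (1 - P), ← rank_mul_eq_left_of_isUnit_det _ (1 - P)ᵀ hJ, h,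
      rank_mul_eq_right_of_isUnit_det _ _ hJ]
  have hle := rank_add_rank_le_card_of_mul_eq_zero hPP
  have hge := card_le_rank_add_rank_one_sub P
  simp only [Fintype.card_sum, Fintype.card_fin] at hle hge
  obtain ⟨S, hS, hPS⟩ := exists_isUnit_mul_eq_mul_fromBlocks (P := P) (n := n)
    (by omega) (by omega)
  have hAS : A * S = S * fromBlocks (i • 1) 0 0 (-i • 1) := by
    have hD : (fromBlocks (i • 1) 0 0 (-i • 1) : Matrix (Fin n ⊕ Fin n) (Fin n ⊕ Fin n) k) =
        i • ((2 : k) • fromBlocks 1 0 0 0 - 1) := by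
      rw [← fromBlocks_one, fromBlocks_smul, sub_eq_add_neg, fromBlocks_neg, fromBlocks_add,
        fromBlocks_smul]
      simp [two_smul]
    rw [hD, hAP]
    simp [sub_mul, mul_sub, hPS]
  obtain ⟨T, hT, hTD⟩ := exists_congr_SpJ (G := Sᵀ * SpJ n k * S) hchar hi
    (((S.isUnit_transpose.2 hS).mul (isUnit_SpJ k)).mul hS)
    (by simp [transpose_mul, SpJ_transpose, Matrix.mul_assoc])
    (by
      have hDt : (fromBlocks (i • 1) 0 0 (-i • 1) :
          Matrix (Fin n ⊕ Fin n) (Fin n ⊕ Fin n) k)ᵀ = fromBlocks (i • 1) 0 0 (-i • 1) := by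
        simp [fromBlocks_transpose]
      nth_rw 1 [← hDt]
      calc _ = (S * fromBlocks (i • 1) 0 0 (-i • 1))ᵀ * SpJ n k *
            (S * fromBlocks (i • 1) 0 0 (-i • 1)) := by
            simp only [transpose_mul, Matrix.mul_assoc]
        _ = Sᵀ * (Aᵀ * SpJ n k * A) * S := by
            rw [← hAS]
            simp only [transpose_mul, Matrix.mul_assoc]
        _ = _ := by rw [hA])
  refine ⟨S * T, ?_, ?_⟩
  · refine Eq.trans ?_ hT
    simp only [transpose_mul, Matrix.mul_assoc]
  · rw [← Matrix.mul_assoc, hAS, Matrix.mul_assoc, hTD, Matrix.mul_assoc]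

end Symplectic

/-- If `k` contains a square root of `-1`, any two matrices `A, B ∈ Sp(2n,k)` with
`A² = -I = B²` are conjugate by an element of `Sp(2n,k)`. -/
theorem stmt13 {k : Type*} [Field k] (hchar : (2 : k) ≠ 0)
    (i : k) (hi : i ^ 2 = -1) {n : ℕ} (hn : 1 ≤ n)
    (A B : Matrix (Fin n ⊕ Fin n) (Fin n ⊕ Fin n) k)
    (hA : IsSymp A) (hB : IsSymp B) (hA2 : A * A = -1) (hB2 : B * B = -1) :
    ∃ Q : Matrix (Fin n ⊕ Fin n) (Fin n ⊕ Fin n) k, IsSymp Q ∧ Q⁻¹ * A * Q = B := by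
  obtain ⟨Q, hQ, hAQ⟩ := hA.exists_mul_eq_mul_fromBlocks hchar hi hA2
  obtain ⟨R, hR, hBR⟩ := hB.exists_mul_eq_mul_fromBlocks hchar hi hB2
  refine ⟨Q * R⁻¹, hQ.mul hR.inv, ?_⟩
  have hQR := (hQ.mul hR.inv).isUnit_det
  have h : A * (Q * R⁻¹) = Q * R⁻¹ * B := by
    calc A * (Q * R⁻¹) = Q * (R⁻¹ * (R * fromBlocks (i • 1) 0 0 (-i • 1))) * R⁻¹ := by
          rw [nonsing_inv_mul_cancel_left _ _ hR.isUnit_det, ← hAQ, Matrix.mul_assoc]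
      _ = Q * R⁻¹ * B * (R * R⁻¹) := by
          rw [← hBR]
          simp only [Matrix.mul_assoc]
      _ = Q * R⁻¹ * B := by rw [mul_nonsing_inv _ hR.isUnit_det, Matrix.mul_one]
  rw [Matrix.mul_assoc, h, nonsing_inv_mul_cancel_left _ _ hQR]
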